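/- Let U be a p-point ultrafilter on ω. Then U·U ≡_T U if and only if (ω^ω, ≤) ≤_T (U, ⊇), where ≤ is the everywhere-domination order on ω^ω. -/

import Mathlib

open Set

/-- A subset `S` is bounded with respect to the relation `r`. -/
def RelBounded {α : Type*} (r : α → α → Prop) (S : Set α) : Prop :=
  ∃ b, ∀ a ∈ S, r a b

/-- Tukey reducibility between two ordered sets: there is a map sending every
unbounded set to an unbounded set. -/
def TukeyLE {α β : Type*} (ra : α → α → Prop) (rb : β → β → Prop) : Prop :=
  ∃ f : α → β, ∀ S : Set α, ¬ RelBounded ra S → ¬ RelBounded rb (f '' S)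

/-- Tukey equivalence. -/
def TukeyEquiv {α β : Type*} (ra : α → α → Prop) (rb : β → β → Prop) : Prop :=
  TukeyLE ra rb ∧ TukeyLE rb ra

/-- `S` is cofinal with respect to the relation `r`. -/
def IsCofinalIn {α : Type*} (r : α → α → Prop) (S : Set α) : Prop :=
  ∀ a, ∃ b ∈ S, r a b

/-- The poset `(U, ⊇)` associated to a filter `U`: `A ≤ B` iff `A ⊇ B`. -/
def filtRel {X : Type*} (U : Filter X) :
    {A : Set X // A ∈ U} → {A : Set X // A ∈ U} → Prop :=
  fun A B => B.1 ⊆ A.1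

/-- The poset `(I, ⊆)` associated to a family of sets `I`. -/
def subRel {X : Type*} (I : Set (Set X)) :
    {A : Set X // A ∈ I} → {A : Set X // A ∈ I} → Prop :=
  fun A B => A.1 ⊆ B.1

/-- The Fubini product of filters: `A ∈ U·V` iff `{x | (A)_x ∈ V} ∈ U`,
where `(A)_x = {y | (x, y) ∈ A}`. -/
def fubini {X Y : Type*} (U : Filter X) (V : Filter Y) : Filter (X × Y) :=
  U.bind fun x => V.map (Prod.mk x)

/-- The ω-fold power of an ordered set, with the everywhere (pointwise)
domination order. -/
def seqRel {α : Type*} (r : α → α → Prop) : (ℕ → α) → (ℕ → α) → Prop :=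
  fun f g => ∀ n, r (f n) (g n)

/-- The product order on a Cartesian product of two ordered sets. -/
def prodRel {α β : Type*} (ra : α → α → Prop) (rb : β → β → Prop) :
    α × β → α × β → Prop :=
  fun p q => ra p.1 q.1 ∧ rb p.2 q.2

/-- The everywhere domination order on `ω^ω`. -/
def domRel : (ℕ → ℕ) → (ℕ → ℕ) → Prop := fun f g => ∀ n, f n ≤ g n

/-- An ideal on `X`: a family of subsets containing `∅`, closed under subsets
and finite unions. -/
def IsIdeal {X : Type*} (I : Set (Set X)) : Prop :=
  ∅ ∈ I ∧ (∀ A ∈ I, ∀ B ⊆ A, B ∈ I) ∧ (∀ A ∈ I, ∀ B ∈ I, A ∪ B ∈ I)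

/-- `U` has the `I`-pseudo-intersection property: every ω-sequence of members of `U`
has a pseudo-intersection modulo `I` in `U`. -/
def HasPIP {X : Type*} (U : Filter X) (I : Set (Set X)) : Prop :=
  ∀ A : ℕ → Set X, (∀ n, A n ∈ U) → ∃ B ∈ U, ∀ n, B \ A n ∈ I

/-- A p-point: a nonprincipal ultrafilter on `ω` which has the fin-pseudo-intersection
property. -/
def IsPPoint (U : Ultrafilter ℕ) : Prop :=
  (∀ a : ℕ, (U : Filter ℕ) ≠ pure a) ∧
  ∀ A : ℕ → Set ℕ, (∀ n, A n ∈ U) → ∃ B ∈ U, ∀ n, (B \ A n).Finite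

/-- A rapid ultrafilter: a nonprincipal ultrafilter `U` on `ω` such that for every
increasing `f : ω → ω` there is `X ∈ U` with `|X ∩ f(n)| ≤ n` for all `n`. -/
def IsRapid (U : Ultrafilter ℕ) : Prop :=
  (∀ a : ℕ, (U : Filter ℕ) ≠ pure a) ∧
  ∀ f : ℕ → ℕ, StrictMono f → ∃ X ∈ U, ∀ n, (X ∩ Set.Iio (f n)).ncard ≤ n

/-- The ideal `fin ⊗ fin` on `ω × ω`: all sets with only finitely many infinite
vertical sections. -/
def finOtimesFin : Set (Set (ℕ × ℕ)) :=
  {A | {n : ℕ | {m : ℕ | (n, m) ∈ A}.Infinite}.Finite}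

theorem mem_fubini_iff {X Y : Type*} {U : Filter X} {V : Filter Y} {A : Set (X × Y)} :
    A ∈ fubini U V ↔ {x | {y | (x, y) ∈ A} ∈ V} ∈ U :=
  Filter.mem_bind'

/-- A map reflecting boundedness witnesses Tukey reducibility. -/
theorem TukeyLE.of_reflects_bounded {α β : Type*} {ra : α → α → Prop} {rb : β → β → Prop}
    (f : α → β) (h : ∀ (S : Set α) (b : β), (∀ a ∈ S, rb (f a) b) → RelBounded ra S) :
    TukeyLE ra rb :=
  ⟨f, fun S hS ⟨b, hb⟩ => hS (h S b fun a ha => hb (f a) (mem_image_of_mem f ha))⟩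

theorem TukeyLE.exists_reflects_bounded {α β : Type*} {ra : α → α → Prop} {rb : β → β → Prop}
    (h : TukeyLE ra rb) :
    ∃ f : α → β, ∀ (S : Set α) (b : β), (∀ a ∈ S, rb (f a) b) → RelBounded ra S := by
  obtain ⟨f, hf⟩ := h
  refine ⟨f, fun S b hb => ?_⟩
  by_contra hS
  exact hf S hS ⟨b, forall_mem_image.2 hb⟩

theorem TukeyLE.trans {α β γ : Type*} {ra : α → α → Prop} {rb : β → β → Prop}
    {rc : γ → γ → Prop} (hab : TukeyLE ra rb) (hbc : TukeyLE rb rc) : TukeyLE ra rc := by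
  obtain ⟨f, hf⟩ := hab
  obtain ⟨g, hg⟩ := hbc
  refine ⟨g ∘ f, fun S hS => ?_⟩
  rw [image_comp]
  exact hg _ (hf S hS)

theorem tukeyLE_fubini_left {X Y : Type*} (U : Filter X) (V : Filter Y) [V.NeBot] :
    TukeyLE (filtRel U) (filtRel (fubini U V)) := by
  refine .of_reflects_bounded (fun A => ⟨{p | p.1 ∈ A.1}, mem_fubini_iff.2 ?_⟩) ?_
  · filter_upwards [A.2] with x hx
    simp [hx]
  · intro S B hB
    refine ⟨⟨_, mem_fubini_iff.1 B.2⟩, fun A hA x hx => ?_⟩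
    obtain ⟨y, hy⟩ := V.nonempty_of_mem hx
    exact hB A hA hy

/-- `(ω^ω, ≤)` is Tukey below every Fubini product of filters on `ω` extending the Fréchet
filter. -/
theorem domRel_tukeyLE_fubini {U V : Filter ℕ} [U.NeBot] [V.NeBot] (hU : U ≤ Filter.atTop)
    (hV : V ≤ Filter.atTop) : TukeyLE domRel (filtRel (fubini U V)) := by
  refine .of_reflects_bounded
    (fun f => ⟨{p | ∀ i ≤ p.1, f i ≤ p.2}, mem_fubini_iff.2 (Filter.univ_mem' fun x => hV ?_)⟩) ?_
  · exact (Filter.eventually_all_finite (finite_Iic x)).2 fun i _ => Filter.eventually_ge_atTop _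
  · intro S B hB
    have key : ∀ n, ∃ m, ∀ f ∈ S, f n ≤ m := by
      intro n
      obtain ⟨x, hx, hnx⟩ := U.nonempty_of_mem
        (Filter.inter_mem (mem_fubini_iff.1 B.2) (hU (Filter.Ici_mem_atTop n)))
      obtain ⟨y, hy⟩ := V.nonempty_of_mem hx
      exact ⟨y, fun f hf => hB f hf hy n hnx⟩
    choose g hg using key
    exact ⟨g, fun f hf n => hg n f hf⟩

/-- If `V` has the fin-pseudo-intersection property, then a Fubini product `U·V` over `ω` is
Tukey below `U × V × ω^ω`. -/
theorem fubini_tukeyLE_prod {U V : Filter ℕ} (hV : V ≤ Filter.atTop)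
    (hpip : HasPIP V {A | A.Finite}) :
    TukeyLE (filtRel (fubini U V)) (prodRel (filtRel U) (prodRel (filtRel V) domRel)) := by
  have key : ∀ A : {A // A ∈ fubini U V}, ∃ B ∈ V, ∃ f : ℕ → ℕ,
      ∀ x, {y | (x, y) ∈ A.1} ∈ V → ∀ y ∈ B, f x ≤ y → (x, y) ∈ A.1 := by
    intro A
    obtain ⟨B, hB, hfin⟩ := hpip (fun x => {y | {z | (x, z) ∈ A.1} ∈ V → (x, y) ∈ A.1}) (by
      intro x
      by_cases hx : {z | (x, z) ∈ A.1} ∈ V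
      · filter_upwards [hx] with y hy _ using hy
      · simp [hx])
    have hbd : ∀ x, ∃ m, ∀ y ∈ B, m ≤ y → {z | (x, z) ∈ A.1} ∈ V → (x, y) ∈ A.1 := by
      intro x
      obtain ⟨m, hm⟩ := (hfin x).bddAbove
      refine ⟨m + 1, fun y hy hmy => ?_⟩
      by_contra hxy
      have := hm ⟨hy, hxy⟩
      omega
    choose f hf using hbd
    exact ⟨B, hB, f, fun x hx y hy hxy => hf x y hy hxy hx⟩
  choose B hB f hf using key
  refine .of_reflects_bounded
    (fun A => (⟨_, mem_fubini_iff.1 A.2⟩, ⟨B A, hB A⟩, f A)) ?_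
  rintro S ⟨C, D, g⟩ hb
  refine ⟨⟨{p | p.1 ∈ C.1 ∧ p.2 ∈ D.1 ∧ g p.1 ≤ p.2}, mem_fubini_iff.2 ?_⟩, ?_⟩
  · filter_upwards [C.2] with x hx
    filter_upwards [D.2, hV (Filter.Ici_mem_atTop (g x))] with y hy hxy
    exact ⟨hx, hy, hxy⟩
  · rintro A hA ⟨x, y⟩ ⟨hx, hy, hxy⟩
    obtain ⟨hC, hD, hg⟩ := hb A hA
    exact hf A x (hC hx) y (hD hy) ((hg x).trans hxy)

/-- The poset of a filter is a join-semilattice, so its Tukey lower sets are closed under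
products. -/
theorem prodRel_tukeyLE_filtRel {α β X : Type*} {ra : α → α → Prop} {rb : β → β → Prop}
    {U : Filter X} (ha : TukeyLE ra (filtRel U)) (hb : TukeyLE rb (filtRel U)) :
    TukeyLE (prodRel ra rb) (filtRel U) := by
  obtain ⟨f, hf⟩ := ha.exists_reflects_bounded
  obtain ⟨g, hg⟩ := hb.exists_reflects_bounded
  refine .of_reflects_bounded
    (fun p => ⟨(f p.1).1 ∩ (g p.2).1, Filter.inter_mem (f p.1).2 (g p.2).2⟩) ?_
  intro S C hC
  obtain ⟨a, ha⟩ := hf (Prod.fst '' S) C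
    (forall_mem_image.2 fun p hp => (hC p hp).trans inter_subset_left)
  obtain ⟨b, hb⟩ := hg (Prod.snd '' S) C
    (forall_mem_image.2 fun p hp => (hC p hp).trans inter_subset_right)
  exact ⟨(a, b), fun p hp => ⟨ha _ (mem_image_of_mem _ hp), hb _ (mem_image_of_mem _ hp)⟩⟩

theorem tukeyLE_refl {α : Type*} (r : α → α → Prop) : TukeyLE r r :=
  .of_reflects_bounded id fun _ b hb => ⟨b, hb⟩

theorem IsPPoint.le_atTop {U : Ultrafilter ℕ} (hU : IsPPoint U) :
    (U : Filter ℕ) ≤ Filter.atTop := by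
  rw [← Nat.cofinite_eq_atTop]
  refine U.le_cofinite_or_eq_pure.resolve_right ?_
  rintro ⟨a, ha⟩
  exact hU.1 a (by rw [ha]; rfl)

/-- For a p-point `U` on `ω`: `U·U ≡_T U` iff `(ω^ω, ≤) ≤_T (U, ⊇)`. -/
theorem stmt7 (U : Ultrafilter ℕ) (hU : IsPPoint U) :
    TukeyEquiv (filtRel (fubini (U : Filter ℕ) (U : Filter ℕ)))
      (filtRel (U : Filter ℕ)) ↔
    TukeyLE domRel (filtRel (U : Filter ℕ)) := by
  have hle := hU.le_atTop
  constructor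
  · intro h
    exact (domRel_tukeyLE_fubini hle hle).trans h.1
  · intro h
    have hrefl := tukeyLE_refl (filtRel (U : Filter ℕ))
    exact ⟨(fubini_tukeyLE_prod hle hU.2).trans
      (prodRel_tukeyLE_filtRel hrefl (prodRel_tukeyLE_filtRel hrefl h)),
      tukeyLE_fubini_left _ _⟩
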